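/- arXiv:1811.08558 — 2 statements merged into one kernel-verified Lean document; each statement's English description precedes it below -/
import Mathlib

section
/- The Duflo map preserves invariance: if P ∈ S(g)^g then D(P) ∈ U(g)^g, i.e. x·D(P) − D(P)·x = 0 in U(g) for every x ∈ g. -/
noncomputable section

open scoped BigOperators

/-- Formal exponential of a power series (intended for series with zero constant term). -/
def expPS (F : PowerSeries ℚ) : PowerSeries ℚ :=
  PowerSeries.mk fun n =>
    ∑ k ∈ Finset.range (n + 1), ((k.factorial : ℚ))⁻¹ * PowerSeries.coeff n (F ^ k)

/-- The power series of sinh(x/2)/(x/2) = Σ_{k≥0} x^{2k} / (4^k (2k+1)!). -/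
def sinhHalfSeries : PowerSeries ℚ :=
  PowerSeries.mk fun n => if n % 2 = 0 then ((4 ^ (n / 2) * (n + 1).factorial : ℚ))⁻¹ else 0

variable {K : Type} [Field K] [CharZero K]
variable {L : Type} [LieRing L] [LieAlgebra K L]
variable {m : ℕ}

/-- The polynomial function x ↦ Tr((ad_x)^n) on g, written in the coordinates given by the
basis `b` (the variable `X i` is the `i`-th coordinate, i.e. the dual basis vector `bᵢ*`). -/
def adTracePoly (b : Module.Basis (Fin m) K L) (n : ℕ) : MvPolynomial (Fin m) K :=
  ∑ f : Fin n → Fin m,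
    (LinearMap.trace K L (List.ofFn fun j => (LieAlgebra.ad K L (b (f j)) : Module.End K L)).prod) •
      ∏ j, MvPolynomial.X (f j)

/-- The degree-`r` homogeneous component `δ_r` of the formal series
`exp (Σ_{n ≥ 1} 2 c_{2n} T_{2n})` in S(g*). -/
def dufloSymbol (b : Module.Basis (Fin m) K L) (c : ℕ → ℚ) (r : ℕ) : MvPolynomial (Fin m) K :=
  MvPolynomial.homogeneousComponent r
    (∑ k ∈ Finset.range (r + 1), ((k.factorial : K))⁻¹ •
      (∑ n ∈ Finset.Icc 1 r, ((2 * c (2 * n) : ℚ) : K) • adTracePoly b (2 * n)) ^ k)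

/-- Symmetrization of the monomial with exponent vector `α`:
`(1/d!) Σ_{σ ∈ S_d} x_{σ(1)} ⋯ x_{σ(d)}` in U(g). -/
def symmMonomial (b : Module.Basis (Fin m) K L) (α : Fin m →₀ ℕ) : UniversalEnvelopingAlgebra K L :=
  ((α.toMultiset.toList.length.factorial : K))⁻¹ •
    ∑ σ : Equiv.Perm (Fin α.toMultiset.toList.length),
      (List.ofFn fun j =>
        UniversalEnvelopingAlgebra.ι K (b (α.toMultiset.toList.get (σ j)))).prod

/-- The symmetrization map β : S(g) → U(g). -/
def symmetrization (b : Module.Basis (Fin m) K L) (P : MvPolynomial (Fin m) K) :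
    UniversalEnvelopingAlgebra K L :=
  ∑ α ∈ P.support, MvPolynomial.coeff α P • symmMonomial b α

/-- The differential operator `∂^α = ∏ᵢ (∂/∂bᵢ)^(α i)` on S(g). -/
def diffOpMon (α : Fin m →₀ ℕ) : Module.End K (MvPolynomial (Fin m) K) :=
  ((List.finRange m).map fun i =>
    (((MvPolynomial.pderiv i).toLinearMap : Module.End K (MvPolynomial (Fin m) K)) ^ (α i))).prod

/-- The constant-coefficient differential operator `δ(∂)` applied to `P`; each dual basis
vector `bᵢ*` occurring in `δ` is replaced by `∂/∂bᵢ`. -/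
def diffOp (δ P : MvPolynomial (Fin m) K) : MvPolynomial (Fin m) K :=
  ∑ α ∈ δ.support, MvPolynomial.coeff α δ • diffOpMon (K := K) α P

/-- The Duflo map `D(P) = Σ_r β(δ_r(∂) P)` (a finite sum). -/
def duflo (b : Module.Basis (Fin m) K L) (c : ℕ → ℚ) (P : MvPolynomial (Fin m) K) :
    UniversalEnvelopingAlgebra K L :=
  ∑ r ∈ Finset.range (P.totalDegree + 1), symmetrization b (diffOp (dufloSymbol b c r) P)

/-- The degree-one polynomial representing `y ∈ g` in the coordinates given by `b`. -/
def linPoly (b : Module.Basis (Fin m) K L) (y : L) : MvPolynomial (Fin m) K :=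
  ∑ j, b.repr y j • MvPolynomial.X j

/-- The adjoint action of `x ∈ g` on S(g), extended from g as a derivation. -/
def adS (b : Module.Basis (Fin m) K L) (x : L) :
    MvPolynomial (Fin m) K →ₗ[K] MvPolynomial (Fin m) K :=
  (MvPolynomial.mkDerivation K fun i => linPoly b ⁅x, b i⁆).toLinearMap

end

noncomputable section

variable {K : Type} [Field K] [CharZero K]
variable {L : Type} [LieRing L] [LieAlgebra K L]
variable {m : ℕ}

section

omit [CharZero K]

attribute [local instance] LieRing.ofAssociativeRing

/-- The Leibniz rule for a product of a finite list, for an additive map on a possibly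
noncommutative ring. -/
theorem leibniz_prod_ofFn {A : Type*} [Ring A] (d : A →+ A)
    (hd : ∀ a b, d (a * b) = d a * b + a * d b) {n : ℕ} (u : Fin n → A) :
    d (List.ofFn u).prod = ∑ j, (List.ofFn (Function.update u j (d (u j)))).prod := by
  have h1 : d 1 = 0 := by simpa using hd 1 1
  induction n with
  | zero => simpa using h1
  | succ n ih =>
    have h0 : ∀ v : A, List.ofFn (fun i : Fin n => Function.update u 0 v i.succ)
        = List.ofFn fun i : Fin n => u i.succ := fun v => by
      congr 1
    have hs : ∀ (j : Fin n) (v : A), (fun i : Fin n => Function.update u j.succ v i.succ)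
        = Function.update (fun i : Fin n => u i.succ) j v := fun j v => by
      funext i
      simp [Function.update_apply]
    simp only [List.ofFn_succ, List.prod_cons, hd, ih, Fin.sum_univ_succ, h0, hs,
      Function.update_self, Finset.mul_sum]
    congr 1

/-- `linPoly` as a linear map. -/
def linPolyHom (b : Module.Basis (Fin m) K L) : L →ₗ[K] MvPolynomial (Fin m) K where
  toFun := linPoly b
  map_add' y z := by simp [linPoly, add_smul, Finset.sum_add_distrib]
  map_smul' a y := by simp [linPoly, mul_smul, Finset.smul_sum]

theorem linPolyHom_apply (b : Module.Basis (Fin m) K L) (y : L) :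
    linPolyHom b y = linPoly b y := rfl

theorem linPoly_basis (b : Module.Basis (Fin m) K L) (i : Fin m) :
    linPoly b (b i) = MvPolynomial.X i := by
  simp [linPoly, Finsupp.single_apply]

theorem adS_linPoly (b : Module.Basis (Fin m) K L) (x y : L) :
    adS b x (linPoly b y) = linPoly b ⁅x, y⁆ := by
  have key : adS b x ∘ₗ linPolyHom b = linPolyHom b ∘ₗ (LieAlgebra.ad K L x : L →ₗ[K] L) := by
    refine b.ext fun i => ?_
    simp only [LinearMap.comp_apply, linPolyHom_apply, linPoly_basis]
    exact MvPolynomial.mkDerivation_X _ _ _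
  exact LinearMap.congr_fun key y

/-- The symmetrization map as a linear map. -/
def symmetrizationHom (b : Module.Basis (Fin m) K L) :
    MvPolynomial (Fin m) K →ₗ[K] UniversalEnvelopingAlgebra K L :=
  Finsupp.linearCombination K (symmMonomial b) ∘ₗ
    (MvPolynomial.basisMonomials (Fin m) K).repr.toLinearMap

theorem symmetrizationHom_apply (b : Module.Basis (Fin m) K L) (P : MvPolynomial (Fin m) K) :
    symmetrizationHom b P = symmetrization b P := rfl

theorem symmetrizationHom_monomial (b : Module.Basis (Fin m) K L) (α : Fin m →₀ ℕ) (a : K) :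
    symmetrizationHom b (MvPolynomial.monomial α a) = a • symmMonomial b α :=
  Finsupp.linearCombination_single K a α

/-- The sum of `y_{σ(1)} ⋯ y_{σ(n)}` over all permutations `σ`, as a multilinear map. -/
def symmSum (K L : Type) [Field K] [LieRing L] [LieAlgebra K L] (n : ℕ) :
    MultilinearMap K (fun _ : Fin n => L) (UniversalEnvelopingAlgebra K L) :=
  ∑ σ : Equiv.Perm (Fin n),
    ((MultilinearMap.mkPiAlgebraFin K n (UniversalEnvelopingAlgebra K L)).compLinearMap
      fun _ => (UniversalEnvelopingAlgebra.ι K (L := L)).toLinearMap).domDomCongr σ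

theorem symmSum_apply {n : ℕ} (y : Fin n → L) :
    symmSum K L n y = ∑ σ : Equiv.Perm (Fin n),
      (List.ofFn fun j => UniversalEnvelopingAlgebra.ι K (y (σ j))).prod := by
  simp only [symmSum, sum_apply, MultilinearMap.domDomCongr_apply,
    MultilinearMap.compLinearMap_apply, MultilinearMap.mkPiAlgebraFin_apply]
  rfl

theorem symmSum_comp_perm {n : ℕ} (y : Fin n → L) (τ : Equiv.Perm (Fin n)) :
    symmSum K L n (y ∘ τ) = symmSum K L n y := by
  simp only [symmSum_apply]
  exact Equiv.sum_comp (Equiv.mulLeft τ) fun σ : Equiv.Perm (Fin n) =>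
    (List.ofFn fun j => UniversalEnvelopingAlgebra.ι K (y (σ j))).prod

theorem symmSum_comp_eq (y : Fin m → L) {n : ℕ} {f g : Fin n → Fin m}
    (h : (List.ofFn f).Perm (List.ofFn g)) : symmSum K L n (y ∘ f) = symmSum K L n (y ∘ g) := by
  have hfg : f ∘ Tuple.sort f = g ∘ Tuple.sort g :=
    List.ofFn_injective <|
      ((((Tuple.sort f).ofFn_comp_perm f).trans h).trans
        ((Tuple.sort g).ofFn_comp_perm g).symm).eq_of_pairwise'
        (Tuple.monotone_sort f).sortedLE_ofFn.pairwise
        (Tuple.monotone_sort g).sortedLE_ofFn.pairwise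
  rw [← symmSum_comp_perm (y ∘ f) (Tuple.sort f), ← symmSum_comp_perm (y ∘ g) (Tuple.sort g),
    Function.comp_assoc, Function.comp_assoc, hfg]

theorem symmMonomial_eq (b : Module.Basis (Fin m) K L) (α : Fin m →₀ ℕ) {n : ℕ} (f : Fin n → Fin m)
    (h : α.toMultiset = Finset.univ.val.map f) :
    symmMonomial b α = (n.factorial : K)⁻¹ • symmSum K L n (b ∘ f) := by
  have key : ∀ l : List (Fin m), (l : Multiset (Fin m)) = Finset.univ.val.map f →
      (l.length.factorial : K)⁻¹ • ∑ σ : Equiv.Perm (Fin l.length),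
        (List.ofFn fun j => UniversalEnvelopingAlgebra.ι K (b (l.get (σ j)))).prod
      = (n.factorial : K)⁻¹ • symmSum K L n (b ∘ f) := by
    intro l hl
    have hn : l.length = n := by simpa using congrArg Multiset.card hl
    subst hn
    have hp : (List.ofFn l.get).Perm (List.ofFn f) := by
      rw [← Multiset.coe_eq_coe, List.ofFn_get, hl, Fin.univ_val_map]
    rw [← symmSum_comp_eq b hp, symmSum_apply]
    rfl
  exact key _ (by rw [Multiset.coe_toList, h])

theorem symmetrization_prod_linPoly (b : Module.Basis (Fin m) K L) {n : ℕ} (y : Fin n → L) :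
    symmetrizationHom b (∏ j, linPoly b (y j)) = (n.factorial : K)⁻¹ • symmSum K L n y := by
  have key : (symmetrizationHom b).compMultilinearMap
      ((MultilinearMap.mkPiAlgebra K (Fin n) (MvPolynomial (Fin m) K)).compLinearMap
        fun _ => linPolyHom b) = (n.factorial : K)⁻¹ • symmSum K L n := by
    refine Module.Basis.ext_multilinear (fun _ => b) fun f => ?_
    have hX : ∏ j, MvPolynomial.X (R := K) (f j)
        = MvPolynomial.monomial (∑ j, Finsupp.single (f j) 1) 1 := by
      rw [MvPolynomial.monomial_sum_one]
      rfl
    simp only [LinearMap.compMultilinearMap_apply, MultilinearMap.compLinearMap_apply,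
      MultilinearMap.mkPiAlgebra_apply, linPolyHom_apply, linPoly_basis, smul_apply]
    rw [hX, symmetrizationHom_monomial, one_smul]
    refine symmMonomial_eq b _ f ?_
    simp only [map_sum, Finsupp.toMultiset_single, one_smul]
    rw [Finset.sum_eq_multiset_sum, ← Multiset.sum_map_singleton (Finset.univ.val.map f),
      Multiset.map_map]
    rfl
  exact congrArg (fun F => F y) key

theorem ι_commutator_symmSum (x : L) {n : ℕ} (y : Fin n → L) :
    UniversalEnvelopingAlgebra.ι K x * symmSum K L n y
      - symmSum K L n y * UniversalEnvelopingAlgebra.ι K x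
      = ∑ j, symmSum K L n (Function.update y j ⁅x, y j⁆) := by
  set a := UniversalEnvelopingAlgebra.ι K x
  let d : UniversalEnvelopingAlgebra K L →+ UniversalEnvelopingAlgebra K L :=
    AddMonoidHom.mulLeft a - AddMonoidHom.mulRight a
  have hd : ∀ u v, d (u * v) = d u * v + u * d v := fun u v => by
    simp only [d, AddMonoidHom.sub_apply, AddMonoidHom.coe_mulLeft, AddMonoidHom.mulRight_apply]
    noncomm_ring
  have hdι : ∀ z : L, d (UniversalEnvelopingAlgebra.ι K z) = UniversalEnvelopingAlgebra.ι K ⁅x, z⁆ :=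
    fun z => ((UniversalEnvelopingAlgebra.ι K).map_lie x z).symm
  change d (symmSum K L n y) = _
  simp only [symmSum_apply, map_sum]
  rw [Finset.sum_comm]
  refine Finset.sum_congr rfl fun σ _ => ?_
  rw [leibniz_prod_ofFn d hd]
  refine (Finset.sum_congr rfl fun j _ => ?_).trans (Equiv.sum_comp σ fun j =>
    (List.ofFn fun k =>
      UniversalEnvelopingAlgebra.ι K (Function.update y j ⁅x, y j⁆ (σ k))).prod)
  congr 2
  funext k
  by_cases hk : k = j
  · subst hk
    simp only [Function.update_self, hdι]
  · rw [Function.update_of_ne hk, Function.update_of_ne (σ.injective.ne hk)]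

theorem adS_prod_linPoly (b : Module.Basis (Fin m) K L) (x : L) {n : ℕ} (y : Fin n → L) :
    adS b x (∏ j, linPoly b (y j))
      = ∑ j, ∏ k, linPoly b (Function.update y j ⁅x, y j⁆ k) := by
  have h := leibniz_prod_ofFn (adS b x).toAddMonoidHom
    (fun p q => by
      simp only [adS, LinearMap.toAddMonoidHom_coe, Derivation.coeFn_coe, Derivation.leibniz,
        smul_eq_mul]
      ring) fun j => linPoly b (y j)
  simp only [List.prod_ofFn, LinearMap.toAddMonoidHom_coe, adS_linPoly] at h
  rw [h]
  refine Finset.sum_congr rfl fun j _ => Finset.prod_congr rfl fun k _ => ?_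
  by_cases hk : k = j
  · subst hk
    simp
  · simp [hk]

/-- The symmetrization map intertwines the adjoint actions on `S(g)` and `U(g)`. -/
theorem ι_commutator_symmetrization (b : Module.Basis (Fin m) K L) (x : L)
    (P : MvPolynomial (Fin m) K) :
    UniversalEnvelopingAlgebra.ι K x * symmetrization b P
      - symmetrization b P * UniversalEnvelopingAlgebra.ι K x = symmetrization b (adS b x P) := by
  simp only [← symmetrizationHom_apply]
  induction P using MvPolynomial.induction_on' with
  | monomial α a =>
    have hα : MvPolynomial.monomial α a
        = a • ∏ j, linPoly b (b (α.toMultiset.toList.get j)) := by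
      simp only [linPoly_basis]
      rw [← List.prod_ofFn, List.ofFn_comp', List.ofFn_get, ← Multiset.prod_coe,
        ← Multiset.map_coe, Multiset.coe_toList, Finsupp.toMultiset_map, Finsupp.prod_toMultiset,
        MvPolynomial.monomial_eq, MvPolynomial.smul_eq_C_mul,
        Finsupp.prod_mapDomain_index (fun _ => pow_zero _) fun _ _ _ => pow_add _ _ _]
    simp only [hα, map_smul, mul_smul_comm, smul_mul_assoc, ← smul_sub, adS_prod_linPoly, map_sum,
      symmetrization_prod_linPoly, ι_commutator_symmSum, Finset.smul_sum]
  | add p q hp hq =>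
    simp only [map_add, ← hp, ← hq]
    noncomm_ring

/-- The coadjoint action of `x` on `S(g*)`, extended from `g*` as a derivation. -/
def coadS (b : Module.Basis (Fin m) K L) (x : L) :
    Derivation K (MvPolynomial (Fin m) K) (MvPolynomial (Fin m) K) :=
  MvPolynomial.mkDerivation K fun i => -∑ j, b.repr ⁅x, b j⁆ i • MvPolynomial.X j

/-- `diffOp` as a linear map in the symbol. -/
def diffOpHom (m : ℕ) (K : Type) [Field K] :
    MvPolynomial (Fin m) K →ₗ[K] Module.End K (MvPolynomial (Fin m) K) :=
  Finsupp.linearCombination K diffOpMon ∘ₗ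
    (MvPolynomial.basisMonomials (Fin m) K).repr.toLinearMap

theorem diffOpHom_apply (δ P : MvPolynomial (Fin m) K) : diffOpHom m K δ P = diffOp δ P := by
  have h : diffOpHom m K δ = ∑ α ∈ δ.support, MvPolynomial.coeff α δ • diffOpMon α := rfl
  simp [h, diffOp]

theorem diffOpHom_monomial (α : Fin m →₀ ℕ) (a : K) :
    diffOpHom m K (MvPolynomial.monomial α a) = a • diffOpMon α := by
  exact Finsupp.linearCombination_single K a α

theorem pderiv_commute (i j : Fin m) :
    Commute ((MvPolynomial.pderiv i).toLinearMap : Module.End K (MvPolynomial (Fin m) K))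
      (MvPolynomial.pderiv j).toLinearMap := by
  have h : ⁅(MvPolynomial.pderiv i : Derivation K (MvPolynomial (Fin m) K) _),
      (MvPolynomial.pderiv j : Derivation K (MvPolynomial (Fin m) K) _)⁆ = 0 := by
    refine MvPolynomial.derivation_ext fun k => ?_
    simp [Derivation.commutator_apply, MvPolynomial.pderiv_X, Pi.single_apply, apply_ite]
  refine LinearMap.ext fun p => ?_
  simpa [Derivation.commutator_apply, sub_eq_zero] using DFunLike.congr_fun h p

theorem prod_map_pow_add {ι M : Type*} [Monoid M] (f : ι → M) (hf : ∀ i j, Commute (f i) (f j))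
    (α β : ι → ℕ) (l : List ι) :
    (l.map fun i => f i ^ (α i + β i)).prod
      = (l.map fun i => f i ^ α i).prod * (l.map fun i => f i ^ β i).prod := by
  induction l with
  | nil => simp
  | cons i l ih =>
    have hc : Commute (f i ^ β i) (l.map fun i => f i ^ α i).prod :=
      Commute.list_prod_right _ _ fun y hy => by
        obtain ⟨j, -, rfl⟩ := List.mem_map.1 hy
        exact (hf i j).pow_pow _ _
    rw [List.map_cons, List.prod_cons, ih, List.map_cons, List.prod_cons, List.map_cons,
      List.prod_cons, pow_add, mul_assoc, mul_assoc, ← mul_assoc (f i ^ β i), hc.eq, mul_assoc]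

theorem diffOpMon_add (α β : Fin m →₀ ℕ) :
    diffOpMon (K := K) (α + β) = diffOpMon α * diffOpMon β :=
  prod_map_pow_add _ pderiv_commute α β _

theorem diffOpMon_single (i : Fin m) :
    diffOpMon (K := K) (Finsupp.single i 1) = (MvPolynomial.pderiv i).toLinearMap := by
  rw [diffOpMon, List.prod_map_eq_pow_single i]
  · simp [List.count_eq_one_of_mem (List.nodup_finRange m) (List.mem_finRange i)]
  · intro j hj _
    simp [hj.symm]

theorem diffOpHom_mul (p q : MvPolynomial (Fin m) K) :
    diffOpHom m K (p * q) = diffOpHom m K p * diffOpHom m K q := by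
  induction p using MvPolynomial.induction_on' with
  | monomial α a =>
    induction q using MvPolynomial.induction_on' with
    | monomial β b =>
      rw [MvPolynomial.monomial_mul, diffOpHom_monomial, diffOpHom_monomial, diffOpHom_monomial,
        diffOpMon_add, smul_mul_smul_comm]
    | add q r hq hr => simp only [mul_add, map_add, hq, hr]
  | add p r hp hr => simp only [add_mul, map_add, hp, hr]

theorem diffOpHom_X (i : Fin m) :
    diffOpHom m K (MvPolynomial.X i) = (MvPolynomial.pderiv i).toLinearMap := by
  rw [MvPolynomial.X, diffOpHom_monomial, diffOpMon_single, one_smul]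

theorem diffOpHom_C (a : K) : diffOpHom m K (MvPolynomial.C a) = a • 1 := by
  rw [← MvPolynomial.monomial_zero', diffOpHom_monomial]
  simp [diffOpMon]

theorem coadS_X (b : Module.Basis (Fin m) K L) (x : L) (i : Fin m) :
    coadS b x (MvPolynomial.X i) = -∑ j, b.repr ⁅x, b j⁆ i • MvPolynomial.X j :=
  MvPolynomial.mkDerivation_X _ _ _

theorem derivation_sum_apply {ι : Type*} (s : Finset ι)
    (D : ι → Derivation K (MvPolynomial (Fin m) K) (MvPolynomial (Fin m) K))
    (p : MvPolynomial (Fin m) K) : (∑ i ∈ s, D i) p = ∑ i ∈ s, D i p := by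
  rw [← Finset.sum_apply]
  exact congrFun (map_sum Derivation.coeFnAddMonoidHom D s) p

theorem adS_commutator_pderiv (b : Module.Basis (Fin m) K L) (x : L) (i : Fin m) :
    adS b x * (MvPolynomial.pderiv i).toLinearMap - (MvPolynomial.pderiv i).toLinearMap * adS b x
      = diffOpHom m K (coadS b x (MvPolynomial.X i)) := by
  have h : ⁅MvPolynomial.mkDerivation K fun k => linPoly b ⁅x, b k⁆,
      (MvPolynomial.pderiv i : Derivation K (MvPolynomial (Fin m) K) _)⁆
      = -∑ j, b.repr ⁅x, b j⁆ i • MvPolynomial.pderiv j := by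
    refine MvPolynomial.derivation_ext fun k => ?_
    simp [Derivation.commutator_apply, MvPolynomial.pderiv_X, Pi.single_apply, apply_ite, linPoly,
      derivation_sum_apply]
  refine LinearMap.ext fun p => ?_
  refine (DFunLike.congr_fun h p).trans ?_
  simp [coadS_X, diffOpHom_X, derivation_sum_apply]

/-- The commutator of the adjoint action with a constant-coefficient operator is given by the
coadjoint action on the symbol. -/
theorem adS_commutator_diffOpHom (b : Module.Basis (Fin m) K L) (x : L)
    (δ : MvPolynomial (Fin m) K) :
    adS b x * diffOpHom m K δ - diffOpHom m K δ * adS b x = diffOpHom m K (coadS b x δ) := by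
  induction δ using MvPolynomial.induction_on with
  | C a => simp [diffOpHom_C, MvPolynomial.derivation_C]
  | add p q hp hq =>
    simp only [map_add, ← hp, ← hq]
    noncomm_ring
  | mul_X p i hp =>
    rw [Derivation.leibniz, smul_eq_mul, smul_eq_mul, map_add, mul_comm (MvPolynomial.X i),
      diffOpHom_mul, diffOpHom_mul, diffOpHom_mul, ← hp, ← adS_commutator_pderiv, diffOpHom_X]
    generalize diffOpHom m K p = P
    simp only [mul_sub, sub_mul, mul_assoc]
    abel

/-- The matrix over the coordinate ring of `g` with constant entries given by an endomorphism. -/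
def constMatrix (b : Module.Basis (Fin m) K L) :
    Module.End K L →ₐ[K] Matrix (Fin m) (Fin m) (MvPolynomial (Fin m) K) :=
  (Algebra.ofId K (MvPolynomial (Fin m) K)).mapMatrix.comp (LinearMap.toMatrixAlgEquiv b).toAlgHom

theorem trace_constMatrix (b : Module.Basis (Fin m) K L) (E : Module.End K L) :
    (constMatrix b E).trace = MvPolynomial.C (LinearMap.trace K L E) := by
  rw [LinearMap.trace_eq_matrix_trace K b, Matrix.trace, Matrix.trace, map_sum]
  rfl

/-- The matrix of `ad` of the generic point of `g`. -/
def genericAd (b : Module.Basis (Fin m) K L) :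
    Matrix (Fin m) (Fin m) (MvPolynomial (Fin m) K) :=
  ∑ i, (MvPolynomial.X i : MvPolynomial (Fin m) K) • constMatrix b (LieAlgebra.ad K L (b i))

theorem adTracePoly_eq_trace (b : Module.Basis (Fin m) K L) (n : ℕ) :
    adTracePoly b n = (genericAd b ^ n).trace := by
  rw [← MultilinearMap.mkPiAlgebraFin_apply_const (R := MvPolynomial (Fin m) K), genericAd,
    MultilinearMap.map_sum, Matrix.trace_sum, adTracePoly]
  refine Finset.sum_congr rfl fun f _ => ?_
  rw [MultilinearMap.map_smul_univ, Matrix.trace_smul, MultilinearMap.mkPiAlgebraFin_apply,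
    List.ofFn_comp' (fun j => (LieAlgebra.ad K L (b (f j)) : Module.End K L)) (constMatrix b),
    ← map_list_prod, trace_constMatrix, MvPolynomial.smul_eq_C_mul, smul_eq_mul, mul_comm]

theorem coadS_genericAd (b : Module.Basis (Fin m) K L) (x : L) :
    (genericAd b).map (coadS b x)
      = genericAd b * constMatrix b (LieAlgebra.ad K L x)
        - constMatrix b (LieAlgebra.ad K L x) * genericAd b := by
  have h : (genericAd b).map (coadS b x)
      = ∑ i, coadS b x (MvPolynomial.X i) • constMatrix b (LieAlgebra.ad K L (b i)) := by
    refine Matrix.ext fun k l => ?_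
    simp [genericAd, Matrix.sum_apply, constMatrix, mul_comm]
  have h' : ∀ j, ∑ i, b.repr ⁅x, b j⁆ i • constMatrix b (LieAlgebra.ad K L (b i))
      = constMatrix b (LieAlgebra.ad K L x) * constMatrix b (LieAlgebra.ad K L (b j))
        - constMatrix b (LieAlgebra.ad K L (b j)) * constMatrix b (LieAlgebra.ad K L x) := by
    intro j
    simp only [← map_smul, ← map_sum, b.sum_repr, ← map_mul, ← map_sub]
    exact congrArg _ ((LieAlgebra.ad K L).map_lie x (b j))
  rw [h]
  simp only [coadS_X, neg_smul, Finset.sum_smul, Finset.sum_neg_distrib]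
  rw [Finset.sum_comm, ← neg_sub, neg_inj, genericAd, Finset.mul_sum, Finset.sum_mul,
    ← Finset.sum_sub_distrib]
  refine Finset.sum_congr rfl fun j _ => ?_
  rw [mul_smul_comm, smul_mul_assoc, ← smul_sub, ← h', Finset.smul_sum]
  exact Finset.sum_congr rfl fun i _ => by rw [smul_assoc, smul_comm]

theorem map_derivation_mul (d : Derivation K (MvPolynomial (Fin m) K) (MvPolynomial (Fin m) K))
    (A B : Matrix (Fin m) (Fin m) (MvPolynomial (Fin m) K)) :
    (A * B).map d = A.map d * B + A * B.map d := by
  refine Matrix.ext fun i j => ?_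
  simp only [Matrix.map_apply, Matrix.mul_apply, Matrix.add_apply, map_sum, Derivation.leibniz,
    smul_eq_mul, ← Finset.sum_add_distrib]
  rw [Finset.sum_congr rfl fun k _ => by rw [add_comm, mul_comm (B k j)]]

theorem coadS_genericAd_pow (b : Module.Basis (Fin m) K L) (x : L) (n : ℕ) :
    (genericAd b ^ n).map (coadS b x)
      = genericAd b ^ n * constMatrix b (LieAlgebra.ad K L x)
        - constMatrix b (LieAlgebra.ad K L x) * genericAd b ^ n := by
  induction n with
  | zero =>
    ext i j
    simp [Matrix.one_apply, apply_ite]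
  | succ n ih =>
    rw [pow_succ, map_derivation_mul, ih, coadS_genericAd]
    noncomm_ring

theorem coadS_adTracePoly (b : Module.Basis (Fin m) K L) (x : L) (n : ℕ) :
    coadS b x (adTracePoly b n) = 0 := by
  have h := congrArg Matrix.trace (coadS_genericAd_pow b x n)
  rw [Matrix.trace_sub, Matrix.trace_mul_comm, sub_self] at h
  rw [adTracePoly_eq_trace, ← h, Matrix.trace, map_sum]
  rfl

theorem coadS_monomial_isHomogeneous (b : Module.Basis (Fin m) K L) (x : L) (α : Fin m →₀ ℕ)
    (a : K) : (coadS b x (MvPolynomial.monomial α a)).IsHomogeneous α.degree := by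
  rw [coadS, MvPolynomial.mkDerivation_monomial]
  refine Submodule.smul_mem (MvPolynomial.homogeneousSubmodule (Fin m) K α.degree) a ?_
  refine Submodule.sum_mem _ fun i hi => ?_
  have h1 : (α - Finsupp.single i 1).degree + 1 = α.degree := by
    have hle : Finsupp.single i 1 ≤ α := by
      rwa [Finsupp.single_le_iff, Nat.one_le_iff_ne_zero, ← Finsupp.mem_support_iff]
    conv_rhs => rw [← tsub_add_cancel_of_le hle, map_add, Finsupp.degree_single]
  beta_reduce
  rw [smul_eq_mul, MvPolynomial.mem_homogeneousSubmodule, ← h1]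
  refine (MvPolynomial.isHomogeneous_monomial _ rfl).mul ?_
  refine Submodule.neg_mem (MvPolynomial.homogeneousSubmodule (Fin m) K 1) ?_
  exact Submodule.sum_mem _ fun j _ => Submodule.smul_mem _ _ (MvPolynomial.isHomogeneous_X _ _)

theorem coadS_homogeneousComponent (b : Module.Basis (Fin m) K L) (x : L) (r : ℕ)
    (p : MvPolynomial (Fin m) K) :
    coadS b x (MvPolynomial.homogeneousComponent r p)
      = MvPolynomial.homogeneousComponent r (coadS b x p) := by
  induction p using MvPolynomial.induction_on' with
  | monomial α a =>
    rw [MvPolynomial.homogeneousComponent_of_mem (MvPolynomial.isHomogeneous_monomial a rfl),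
      MvPolynomial.homogeneousComponent_of_mem (coadS_monomial_isHomogeneous b x α a),
      apply_ite (coadS b x), map_zero]
  | add p q hp hq => simp only [map_add, hp, hq]

theorem coadS_dufloSymbol (b : Module.Basis (Fin m) K L) (c : ℕ → ℚ) (x : L) (r : ℕ) :
    coadS b x (dufloSymbol b c r) = 0 := by
  rw [dufloSymbol, coadS_homogeneousComponent]
  simp [Derivation.leibniz_pow, coadS_adTracePoly]

end

/-- The Duflo map preserves invariance: if `P ∈ S(g)^g` then `D(P) ∈ U(g)^g`, i.e.
`x·D(P) − D(P)·x = 0` in `U(g)` for every `x ∈ g`. -/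
theorem duflo_map_preserves_invariants
    (b : Module.Basis (Fin m) K L)
    (c : ℕ → ℚ) (hc0 : c 0 = 0)
    (hc : expPS (PowerSeries.mk fun n => 4 * c n) = sinhHalfSeries)
    (P : MvPolynomial (Fin m) K)
    (hP : ∀ x : L, adS b x P = 0) :
    ∀ x : L, UniversalEnvelopingAlgebra.ι K x * duflo b c P
      - duflo b c P * UniversalEnvelopingAlgebra.ι K x = 0 := by
  intro x
  rw [duflo, Finset.mul_sum, Finset.sum_mul, ← Finset.sum_sub_distrib]
  refine Finset.sum_eq_zero fun r _ => ?_
  have h := LinearMap.congr_fun (adS_commutator_diffOpHom b x (dufloSymbol b c r)) P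
  rw [coadS_dufloSymbol, map_zero, LinearMap.sub_apply, Module.End.mul_apply, Module.End.mul_apply,
    hP x, map_zero, sub_zero, diffOpHom_apply] at h
  rw [ι_commutator_symmetrization, h, ← symmetrizationHom_apply]
  simp

end
end

section
/- For square real matrices near zero, the sinh-determinant equals the exponentiated trace series: there exists ε > 0 such that for every n×n real matrix A with operator norm less than ε, the series Σ_{n≥1} 4 c_{2n} Tr(A^{2n}) converges absolutely and det(Σ_{k≥0} A^{2k}/(4^k (2k+1)!)) = exp(Σ_{n≥1} 4 c_{2n} Tr(A^{2n})). -/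
noncomputable section

/-! ### The formal exponential -/

lemma coeff_pow_eq_zero_of_lt {F : PowerSeries ℚ} (hF : PowerSeries.constantCoeff F = 0)
    {n k : ℕ} (h : n < k) : PowerSeries.coeff n (F ^ k) = 0 := by
  have hX : PowerSeries.X ^ k ∣ F ^ k := pow_dvd_pow_of_dvd (PowerSeries.X_dvd_iff.mpr hF) k
  exact PowerSeries.X_pow_dvd_iff.mp hX n h

lemma coeff_expPS_of_le {F : PowerSeries ℚ} (hF : PowerSeries.constantCoeff F = 0)
    {n N : ℕ} (h : n ≤ N) : PowerSeries.coeff n (expPS F) =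
      ∑ k ∈ Finset.range (N + 1), ((k.factorial : ℚ))⁻¹ * PowerSeries.coeff n (F ^ k) := by
  rw [expPS, PowerSeries.coeff_mk]
  refine Finset.sum_subset (Finset.range_mono (by omega)) fun k _ hk => ?_
  rw [coeff_pow_eq_zero_of_lt hF (by simpa using hk), mul_zero]

/-- The differential equation satisfied by `exp F`, read off coefficientwise. -/
lemma coeff_succ_expPS {F : PowerSeries ℚ} (hF : PowerSeries.constantCoeff F = 0) (n : ℕ) :
    ((n : ℚ) + 1) * PowerSeries.coeff (n + 1) (expPS F) =
      ∑ p ∈ Finset.HasAntidiagonal.antidiagonal n, PowerSeries.coeff p.1 (expPS F) *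
        (((p.2 : ℚ) + 1) * PowerSeries.coeff (p.2 + 1) F) := by
  have hpow (k : ℕ) : ((n : ℚ) + 1) * PowerSeries.coeff (n + 1) (F ^ (k + 1)) =
      (k + 1) * ∑ p ∈ Finset.HasAntidiagonal.antidiagonal n, PowerSeries.coeff p.1 (F ^ k) *
        (((p.2 : ℚ) + 1) * PowerSeries.coeff (p.2 + 1) F) := by
    have h := congrArg (PowerSeries.coeff n) (PowerSeries.derivative_pow (R := ℚ) F (k + 1))
    rw [PowerSeries.coeff_derivative, add_tsub_cancel_right, mul_assoc, ← map_natCast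
      (PowerSeries.C (R := ℚ)), PowerSeries.coeff_C_mul, PowerSeries.coeff_mul] at h
    simp only [PowerSeries.coeff_derivative] at h
    rw [mul_comm, h]
    push_cast
    simp only [mul_comm]
  rw [coeff_expPS_of_le hF le_rfl, Finset.sum_range_succ', mul_add, Finset.mul_sum]
  have h0 : PowerSeries.coeff (n + 1) (F ^ 0) = 0 := by simp [PowerSeries.coeff_one]
  rw [h0, mul_zero, mul_zero, add_zero]
  have hR : ∀ p ∈ Finset.HasAntidiagonal.antidiagonal n, PowerSeries.coeff p.1 (expPS F) *
        (((p.2 : ℚ) + 1) * PowerSeries.coeff (p.2 + 1) F) =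
      ∑ k ∈ Finset.range (n + 1), ((k.factorial : ℚ))⁻¹ * (PowerSeries.coeff p.1 (F ^ k) *
        (((p.2 : ℚ) + 1) * PowerSeries.coeff (p.2 + 1) F)) := fun p hp => by
    rw [coeff_expPS_of_le hF (Finset.HasAntidiagonal.mem_antidiagonal.mp hp ▸ Nat.le_add_right _ _),
      Finset.sum_mul]
    simp only [mul_assoc]
  rw [Finset.sum_congr rfl hR, Finset.sum_comm]
  refine Finset.sum_congr rfl fun k _ => ?_
  rw [← Finset.mul_sum, mul_left_comm, hpow, Nat.factorial_succ]
  push_cast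
  have : (k : ℚ) + 1 ≠ 0 := by positivity
  field_simp

/-! ### Convergence of the exponential identity -/

section Scalar

variable {a e : ℕ → ℂ}

lemma norm_le_four_pow_of_deriv_eq (he0 : e 0 = 1) (he : ∀ n, ‖e n‖ ≤ 1)
    (h : ∀ n : ℕ, ((n : ℂ) + 1) * e (n + 1) =
      ∑ p ∈ Finset.HasAntidiagonal.antidiagonal n, e p.1 * (((p.2 : ℂ) + 1) * a (p.2 + 1))) (n : ℕ) :
    ‖((n : ℂ) + 1) * a (n + 1)‖ ≤ 4 ^ n := by
  induction n using Nat.strong_induction_on with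
  | _ n ih =>
    have h1 := h n
    rw [← Finset.Nat.sum_antidiagonal_swap] at h1
    rw [Finset.Nat.sum_antidiagonal_eq_sum_range_succ_mk, Finset.sum_range_succ] at h1
    simp only [Prod.fst_swap, Prod.snd_swap, tsub_self, he0, one_mul] at h1
    rw [← sub_eq_iff_eq_add'.mpr h1]
    have hn : ‖((n : ℂ) + 1) * e (n + 1)‖ ≤ n + 1 := by
      rw [norm_mul]
      have : ‖(n : ℂ) + 1‖ = n + 1 := by exact_mod_cast Complex.norm_natCast (n + 1)
      rw [this]
      exact mul_le_of_le_one_right (by positivity) (he _)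
    have hs : ‖∑ j ∈ Finset.range n, e (n - j) * (((j : ℂ) + 1) * a (j + 1))‖ ≤
        ∑ j ∈ Finset.range n, (4 : ℝ) ^ j := by
      refine norm_sum_le_of_le _ fun j hj => ?_
      rw [norm_mul]
      exact (mul_le_of_le_one_left (norm_nonneg _) (he _)).trans (ih j (Finset.mem_range.mp hj))
    rw [geom_sum_eq (by norm_num)] at hs
    have hb : 1 + (n : ℝ) * 3 ≤ 4 ^ n := by
      have := one_add_mul_le_pow (a := (3 : ℝ)) (by norm_num) n
      norm_num at this ⊢; exact this
    refine (norm_sub_le _ _).trans ?_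
    by_cases hn0 : n = 0
    · subst hn0; simpa using he 1
    · have : (1 : ℝ) ≤ n := by exact_mod_cast Nat.one_le_iff_ne_zero.mpr hn0
      linarith

lemma norm_coeff_le_four_pow (h : ∀ n : ℕ, ‖((n : ℂ) + 1) * a (n + 1)‖ ≤ 4 ^ n) (ha0 : a 0 = 0)
    (n : ℕ) : ‖a n‖ ≤ 4 ^ n := by
  cases n with
  | zero => simp [ha0]
  | succ n =>
    have h1 := h n
    have h2 : ‖(n : ℂ) + 1‖ = n + 1 := by exact_mod_cast Complex.norm_natCast (n + 1)
    rw [norm_mul, h2] at h1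
    have h3 : (4 : ℝ) ^ n ≤ 4 ^ (n + 1) := pow_le_pow_right₀ (by norm_num) (by omega)
    have h4 : (0 : ℝ) ≤ n := by positivity
    nlinarith [norm_nonneg (a (n + 1))]

lemma summable_norm_mul_pow_of_le_four_pow (ha : ∀ n, ‖a n‖ ≤ 4 ^ n) {z : ℂ} (hz : ‖z‖ < 1 / 4) :
    Summable fun n => ‖a n * z ^ n‖ := by
  refine .of_nonneg_of_le (fun _ => norm_nonneg _) (fun n => ?_)
    (summable_geometric_of_lt_one (r := 4 * ‖z‖) (by positivity) (by linarith))
  rw [norm_mul, norm_pow, mul_pow]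
  gcongr
  exact ha n

lemma summable_norm_succ_mul_pow (ha : ∀ n, ‖a n‖ ≤ 4 ^ n) {r : ℝ} (hr0 : 0 ≤ r)
    (hr : r < 1 / 4) : Summable fun n : ℕ => ((n : ℝ) + 1) * ‖a (n + 1)‖ * r ^ n := by
  have h : Summable fun n : ℕ => 4 * ((n : ℝ) ^ 1 * (4 * r) ^ n + (4 * r) ^ n) :=
    ((summable_pow_mul_geometric_of_norm_lt_one 1
      (by rw [Real.norm_of_nonneg (by positivity)]; linarith)).add
      (summable_geometric_of_lt_one (by positivity) (by linarith))).mul_left 4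
  refine .of_nonneg_of_le (fun _ => by positivity) (fun n => ?_) h
  have := ha (n + 1)
  calc ((n : ℝ) + 1) * ‖a (n + 1)‖ * r ^ n ≤ ((n : ℝ) + 1) * 4 ^ (n + 1) * r ^ n := by gcongr
    _ = _ := by rw [mul_pow]; ring

lemma hasDerivAt_tsum_mul_pow (ha : ∀ n, ‖a n‖ ≤ 4 ^ n) {z : ℂ} (hz : ‖z‖ < 1 / 4) :
    HasDerivAt (fun z => ∑' n, a n * z ^ n) (∑' n : ℕ, ((n : ℂ) + 1) * a (n + 1) * z ^ n) z := by
  obtain ⟨r, hzr, hr⟩ := exists_between hz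
  have hr0 : 0 ≤ r := (norm_nonneg z).trans hzr.le
  have hu : Summable fun n : ℕ => (n : ℝ) * ‖a n‖ * r ^ (n - 1) := by
    rw [← summable_nat_add_iff 1]
    simpa using summable_norm_succ_mul_pow ha hr0 hr
  have hb (n : ℕ) (y : ℂ) (hy : y ∈ Metric.ball (0 : ℂ) r) :
      ‖a n * (n * y ^ (n - 1))‖ ≤ (n : ℝ) * ‖a n‖ * r ^ (n - 1) := by
    rw [mem_ball_zero_iff] at hy
    rw [norm_mul, norm_mul, norm_pow, Complex.norm_natCast, mul_left_comm, ← mul_assoc]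
    gcongr
  have hz' : z ∈ Metric.ball (0 : ℂ) r := by simpa using hzr
  have h := hasDerivAt_tsum_of_isPreconnected hu Metric.isOpen_ball
    (convex_ball (0 : ℂ) r).isPreconnected
    (fun n y _ => (hasDerivAt_pow n y).const_mul (a n)) hb hz'
    (summable_norm_mul_pow_of_le_four_pow ha hz).of_norm hz'
  have hs : Summable fun n : ℕ => a n * (n * z ^ (n - 1)) := .of_norm_bounded hu fun n => hb n z hz'
  rw [hs.tsum_eq_zero_add] at h
  simpa [mul_assoc, mul_left_comm] using h

/-- A power series `e` whose formal logarithmic derivative is that of `exp a` sums to `exp a` near `0`. -/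
lemma tsum_eq_exp_tsum_of_deriv_eq (ha0 : a 0 = 0) (he0 : e 0 = 1) (he : ∀ n, ‖e n‖ ≤ 1)
    (h : ∀ n : ℕ, ((n : ℂ) + 1) * e (n + 1) =
      ∑ p ∈ Finset.HasAntidiagonal.antidiagonal n, e p.1 * (((p.2 : ℂ) + 1) * a (p.2 + 1)))
    {z : ℂ} (hz : ‖z‖ < 1 / 4) :
    ∑' n, e n * z ^ n = Complex.exp (∑' n, a n * z ^ n) := by
  have ha := norm_coeff_le_four_pow (norm_le_four_pow_of_deriv_eq he0 he h) ha0
  have he' (n : ℕ) : ‖e n‖ ≤ 4 ^ n := (he n).trans (one_le_pow₀ (by norm_num))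
  have hderiv {w : ℂ} (hw : ‖w‖ < 1 / 4) :
      ∑' n : ℕ, ((n : ℂ) + 1) * e (n + 1) * w ^ n =
        (∑' n, e n * w ^ n) * ∑' n : ℕ, ((n : ℂ) + 1) * a (n + 1) * w ^ n := by
    have hs : Summable fun n : ℕ => ‖((n : ℂ) + 1) * a (n + 1) * w ^ n‖ := by
      convert summable_norm_succ_mul_pow ha (norm_nonneg w) hw using 2 with n
      rw [norm_mul, norm_mul, norm_pow]
      congr 2
      exact_mod_cast Complex.norm_natCast (n + 1)
    rw [tsum_mul_tsum_eq_tsum_sum_antidiagonal_of_summable_norm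
      (summable_norm_mul_pow_of_le_four_pow he' hw) hs]
    refine tsum_congr fun n => ?_
    rw [h, Finset.sum_mul]
    refine Finset.sum_congr rfl fun p hp => ?_
    rw [← Finset.HasAntidiagonal.mem_antidiagonal.mp hp, pow_add]
    ring
  set E : ℂ → ℂ := fun w => ∑' n, e n * w ^ n
  set G : ℂ → ℂ := fun w => ∑' n, a n * w ^ n
  have hG0 : G 0 = 0 := by
    simp only [G]
    rw [tsum_eq_single 0 fun n hn => by simp [hn]]
    simp [ha0]
  have hE0 : E 0 = 1 := by
    simp only [E]
    rw [tsum_eq_single 0 fun n hn => by simp [hn]]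
    simp [he0]
  have hd (w : ℂ) (hw : w ∈ Metric.ball (0 : ℂ) (1 / 4)) :
      HasDerivAt (fun w => E w * Complex.exp (-G w)) 0 w := by
    rw [mem_ball_zero_iff] at hw
    have h1 := hasDerivAt_tsum_mul_pow he' hw
    rw [hderiv hw] at h1
    refine (h1.mul (hasDerivAt_tsum_mul_pow ha hw).neg.cexp).congr_deriv ?_
    simp only [Pi.neg_apply]
    ring
  have hmain : E z * Complex.exp (-G z) = E 0 * Complex.exp (-G 0) :=
    Metric.isOpen_ball.is_const_of_deriv_eq_zero
      (convex_ball (0 : ℂ) (1 / 4)).isPreconnected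
      (fun w hw => (hd w hw).differentiableAt.differentiableWithinAt)
      (fun w hw => (hd w hw).deriv) (by simpa using hz) (by simp)
  rw [hG0, hE0, neg_zero, Complex.exp_zero, mul_one, Complex.exp_neg] at hmain
  exact (mul_inv_eq_one₀ (Complex.exp_ne_zero _)).mp hmain

lemma odd_coeff_eq_zero_of_deriv_eq (he0 : e 0 = 1) (heodd : ∀ n, Odd n → e n = 0)
    (h : ∀ n : ℕ, ((n : ℂ) + 1) * e (n + 1) =
      ∑ p ∈ Finset.HasAntidiagonal.antidiagonal n, e p.1 * (((p.2 : ℂ) + 1) * a (p.2 + 1)))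
    (n : ℕ) (hn : Even n) : a (n + 1) = 0 := by
  induction n using Nat.strong_induction_on with
  | _ n ih =>
    have h1 := h n
    rw [heodd _ hn.add_one, Finset.sum_eq_single (0, n)] at h1
    · have h2 : (n : ℂ) + 1 ≠ 0 := by exact_mod_cast n.succ_ne_zero
      simpa [he0, h2] using h1.symm
    · rintro ⟨i, j⟩ hp hne
      rw [Finset.HasAntidiagonal.mem_antidiagonal] at hp
      simp only at hp ⊢
      rcases Nat.even_or_odd i with hi | hi
      · have hj : Even j := by subst hp; exact (Nat.even_add.mp hn).mp hi
        have hlt : j < n := by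
          rcases Nat.eq_zero_or_pos i with rfl | h0
          · exact absurd (by simp at hp; simp [hp]) hne
          · omega
        rw [ih j hlt hj, mul_zero, mul_zero]
      · rw [heodd i hi, zero_mul]
    · simp

end Scalar

/-! ### Polynomials in a matrix and its eigenvalues -/

section Eigenvalues

open Polynomial

variable {ι : Type*} [Fintype ι] [DecidableEq ι]

lemma Matrix.det_aeval_eq_prod_roots_charpoly {K : Type*} [Field K] [IsAlgClosed K]
    (A : Matrix ι ι K) (p : K[X]) :
    (aeval A p).det = (A.charpoly.roots.map fun x => p.eval x).prod := by
  have hcard : Multiset.card A.charpoly.roots = Fintype.card ι := by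
    rw [← (IsAlgClosed.splits A.charpoly).natDegree_eq_card_roots, A.charpoly_natDegree_eq_dim]
  have hC (b : K) : (aeval A (C b)).det = (A.charpoly.roots.map fun x => (C b).eval x).prod := by
    simp [hcard, Matrix.algebraMap_eq_diagonal]
  have hX (b : K) : (aeval A (X - C b)).det =
      (A.charpoly.roots.map fun x => (X - C b).eval x).prod := by
    have h1 : A.charpoly = (A.charpoly.roots.map fun x => X - C x).prod :=
      (IsAlgClosed.splits A.charpoly).eq_prod_roots_of_monic A.charpoly_monic
    have h2 := Matrix.eval_charpoly A b
    have h3 : aeval A (X - C b) = -(Matrix.scalar ι b - A) := by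
      simp [Matrix.algebraMap_eq_diagonal, Pi.algebraMap_def]
    rw [h3, Matrix.det_neg, ← h2, h1, ← hcard, eval_multiset_prod, Multiset.map_map, ← h1]
    simp only [Function.comp_def, eval_sub, eval_X, eval_C]
    rw [← Multiset.card_map (fun x => b - x), ← Multiset.prod_map_neg, Multiset.map_map]
    simp
  rw [(IsAlgClosed.splits p).eq_prod_roots]
  induction p.roots using Multiset.induction_on with
  | empty => simpa using hC _
  | cons b s ih =>
    rw [Multiset.map_cons, Multiset.prod_cons, mul_left_comm, map_mul, Matrix.det_mul, ih, hX,
      ← Multiset.prod_map_mul]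
    simp only [eval_mul]

lemma Matrix.roots_charpoly_aeval {K : Type*} [Field K] [IsAlgClosed K]
    (A : Matrix ι ι K) (p : K[X]) :
    (aeval A p).charpoly.roots = A.charpoly.roots.map fun x => p.eval x := by
  have h : (aeval A p).charpoly =
      ((A.charpoly.roots.map fun x => p.eval x).map fun x => X - C x).prod := by
    refine Polynomial.funext fun t => ?_
    have h1 : Matrix.scalar ι t - aeval A p = aeval A (C t - p) := by
      simp [Matrix.algebraMap_eq_diagonal, Pi.algebraMap_def]
    rw [Matrix.eval_charpoly, h1, Matrix.det_aeval_eq_prod_roots_charpoly, eval_multiset_prod]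
    simp [Multiset.map_map]
  rw [h, Polynomial.roots_multiset_prod_X_sub_C]

lemma Matrix.trace_pow_eq_sum_roots_charpoly {K : Type*} [Field K] [IsAlgClosed K]
    (A : Matrix ι ι K) (m : ℕ) :
    (A ^ m).trace = (A.charpoly.roots.map fun x => x ^ m).sum := by
  have h := Matrix.roots_charpoly_aeval A (X ^ m)
  rw [map_pow, aeval_X] at h
  rw [Matrix.trace_eq_sum_roots_charpoly, h]
  simp

lemma Matrix.norm_le_of_mem_roots_charpoly_map_ofReal (A : Matrix ι ι ℝ) {z : ℂ}
    (hz : z ∈ (Complex.ofRealHom.mapMatrix A).charpoly.roots) :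
    ‖z‖ ≤ ‖Matrix.toEuclideanCLM (𝕜 := ℝ) A‖ := by
  have hdet : (Matrix.scalar ι z - Complex.ofRealHom.mapMatrix A).det = 0 := by
    rw [← Matrix.eval_charpoly]
    exact (Polynomial.mem_roots'.mp hz).2
  obtain ⟨v, hv0, hv⟩ := Matrix.exists_mulVec_eq_zero_iff.mpr hdet
  have hv' (i : ι) : ∑ j, (A i j : ℂ) * v j = z * v i := by
    have := congrFun hv i
    rw [Matrix.sub_mulVec] at this
    simp [Matrix.mulVec, dotProduct] at this
    exact (sub_eq_zero.mp this).symm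
  set x : EuclideanSpace ℝ ι := WithLp.toLp 2 fun i => (v i).re
  set y : EuclideanSpace ℝ ι := WithLp.toLp 2 fun i => (v i).im
  set T := Matrix.toEuclideanCLM (𝕜 := ℝ) A
  have hTx (i : ι) : T x i = (z * v i).re := by
    rw [← hv']
    simp [T, x, Matrix.mulVec, dotProduct]
  have hTy (i : ι) : T y i = (z * v i).im := by
    rw [← hv']
    simp [T, y, Matrix.mulVec, dotProduct]
  have hsum : ‖T x‖ ^ 2 + ‖T y‖ ^ 2 = ‖z‖ ^ 2 * (‖x‖ ^ 2 + ‖y‖ ^ 2) := by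
    simp only [EuclideanSpace.norm_sq_eq, hTx, hTy, ← Finset.sum_add_distrib, Finset.mul_sum]
    refine Finset.sum_congr rfl fun i _ => ?_
    simp only [Real.norm_eq_abs, sq_abs, x, y, Complex.sq_norm, Complex.normSq_apply,
      Complex.mul_re, Complex.mul_im]
    ring
  have hpos : 0 < ‖x‖ ^ 2 + ‖y‖ ^ 2 := by
    by_contra hle
    have hx : ‖x‖ = 0 := by nlinarith [sq_nonneg ‖x‖, sq_nonneg ‖y‖]
    have hy : ‖y‖ = 0 := by nlinarith [sq_nonneg ‖x‖, sq_nonneg ‖y‖]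
    refine hv0 (funext fun i => Complex.ext ?_ ?_)
    · exact congrArg (fun w : EuclideanSpace ℝ ι => w i) (norm_eq_zero.mp hx)
    · exact congrArg (fun w : EuclideanSpace ℝ ι => w i) (norm_eq_zero.mp hy)
  have hle : ‖T x‖ ^ 2 + ‖T y‖ ^ 2 ≤ ‖T‖ ^ 2 * (‖x‖ ^ 2 + ‖y‖ ^ 2) := by
    rw [mul_add, ← mul_pow, ← mul_pow]
    gcongr <;> exact T.le_opNorm _
  rw [hsum] at hle
  exact le_of_sq_le_sq (le_of_mul_le_mul_right hle hpos) (norm_nonneg _)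

end Eigenvalues

/-! ### The series `sinh (x / 2) / (x / 2)` -/

lemma coeff_sinhHalfSeries_two_mul (k : ℕ) :
    PowerSeries.coeff (2 * k) sinhHalfSeries = ((4 ^ k * (2 * k + 1).factorial : ℚ))⁻¹ := by
  simp [sinhHalfSeries]

lemma coeff_sinhHalfSeries_of_odd {n : ℕ} (hn : Odd n) :
    PowerSeries.coeff n sinhHalfSeries = 0 := by
  simp [sinhHalfSeries, Nat.odd_iff.mp hn]

lemma abs_coeff_sinhHalfSeries_le_one (n : ℕ) :
    |PowerSeries.coeff n sinhHalfSeries| ≤ 1 := by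
  rw [sinhHalfSeries, PowerSeries.coeff_mk]
  split_ifs
  · rw [abs_of_nonneg (by positivity)]
    refine inv_le_one_of_one_le₀ (one_le_mul_of_one_le_of_one_le (one_le_pow₀ (by norm_num)) ?_)
    exact_mod_cast Nat.one_le_iff_ne_zero.mpr (Nat.factorial_ne_zero _)
  · simp

/-- The scalar case: `sinh (z / 2) / (z / 2) = exp (∑ 4 c₂ₙ z²ⁿ)` for small `z`. -/
lemma hasSum_and_exp_eq_of_expPS_eq_sinhHalfSeries {c : PowerSeries ℚ}
    (hc0 : PowerSeries.constantCoeff c = 0) (hc : expPS (4 * c) = sinhHalfSeries)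
    {z : ℂ} (hz : ‖z‖ < 1 / 4) :
    (Summable fun k : ℕ =>
      ‖4 * ((PowerSeries.coeff (2 * (k + 1)) c : ℚ) : ℂ) * z ^ (2 * (k + 1))‖) ∧
    HasSum (fun k : ℕ => ((4 ^ k * (2 * k + 1).factorial : ℂ))⁻¹ * z ^ (2 * k))
      (Complex.exp (∑' k : ℕ,
        4 * ((PowerSeries.coeff (2 * (k + 1)) c : ℚ) : ℂ) * z ^ (2 * (k + 1)))) := by
  have hF0 : PowerSeries.constantCoeff (4 * c) = 0 := by rw [map_mul, hc0, mul_zero]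
  set a : ℕ → ℂ := fun n => 4 * ((PowerSeries.coeff n c : ℚ) : ℂ)
  set e : ℕ → ℂ := fun n => ((PowerSeries.coeff n sinhHalfSeries : ℚ) : ℂ)
  have hcoeff (n : ℕ) : PowerSeries.coeff n (4 * c) = 4 * PowerSeries.coeff n c := by
    rw [← map_ofNat (PowerSeries.C (R := ℚ)) 4, PowerSeries.coeff_C_mul]
  have ha0 : a 0 = 0 := by simp [a, hc0]
  have he0 : e 0 = 1 := by simp [e, sinhHalfSeries]
  have he (n : ℕ) : ‖e n‖ ≤ 1 := by
    have h : ((|PowerSeries.coeff n sinhHalfSeries| : ℚ) : ℝ) ≤ 1 := by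
      exact_mod_cast abs_coeff_sinhHalfSeries_le_one n
    simpa [e, Rat.cast_abs] using h
  have heodd (n : ℕ) (hn : Odd n) : e n = 0 := by simp [e, coeff_sinhHalfSeries_of_odd hn]
  have h (n : ℕ) : ((n : ℂ) + 1) * e (n + 1) = ∑ p ∈ Finset.HasAntidiagonal.antidiagonal n,
      e p.1 * (((p.2 : ℂ) + 1) * a (p.2 + 1)) := by
    have h1 := congrArg (Rat.cast : ℚ → ℂ) (coeff_succ_expPS hF0 n)
    simp only [hc, hcoeff] at h1
    push_cast at h1
    exact h1
  have haodd := odd_coeff_eq_zero_of_deriv_eq he0 heodd h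
  have hsa := summable_norm_mul_pow_of_le_four_pow
    (norm_coeff_le_four_pow (norm_le_four_pow_of_deriv_eq he0 he h) ha0) hz
  have hse := summable_norm_mul_pow_of_le_four_pow
    (fun n => (he n).trans (one_le_pow₀ (by norm_num))) hz
  have hinj : Function.Injective fun k : ℕ => 2 * (k + 1) := fun i j hij => by
    simp only at hij; omega
  have hinj' : Function.Injective fun k : ℕ => 2 * k := fun i j hij => by
    simp only at hij; omega
  have hsupp (n : ℕ) (hn : n ∉ Set.range fun k : ℕ => 2 * (k + 1)) : a n * z ^ n = 0 := by
    cases n with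
    | zero => simp [ha0]
    | succ n =>
      rcases Nat.even_or_odd n with hn' | ⟨k, rfl⟩
      · rw [haodd n hn', zero_mul]
      · exact absurd ⟨k, by ring⟩ hn
  have hsupp' (n : ℕ) (hn : n ∉ Set.range fun k : ℕ => 2 * k) : e n * z ^ n = 0 := by
    rcases Nat.even_or_odd' n with ⟨k, rfl | rfl⟩
    · exact absurd ⟨k, rfl⟩ hn
    · rw [heodd _ ⟨k, rfl⟩, zero_mul]
  refine ⟨hsa.comp_injective hinj, ?_⟩
  have hexp := tsum_eq_exp_tsum_of_deriv_eq ha0 he0 he h hz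
  rw [← ((hinj.hasSum_iff hsupp).mpr hsa.of_norm.hasSum).tsum_eq] at hexp
  have hE := (hinj'.hasSum_iff hsupp').mpr hse.of_norm.hasSum
  rw [hexp] at hE
  convert! hE using 2 with k
  simp [e, coeff_sinhHalfSeries_two_mul]

open scoped Matrix.Norms.L2Operator in
lemma Matrix.summable_sinh_series {ι : Type*} [Fintype ι] [DecidableEq ι] (A : Matrix ι ι ℝ) :
    Summable fun k : ℕ => ((4 ^ k * (2 * k + 1).factorial : ℝ))⁻¹ • A ^ (2 * k) := by
  have hs : Summable fun k : ℕ => ‖(((2 * k).factorial : ℝ))⁻¹ • A ^ (2 * k)‖ :=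
    (NormedSpace.norm_expSeries_summable' (𝕂 := ℝ) A).comp_injective
      (i := fun k : ℕ => 2 * k) fun i j hij => by simp only at hij; omega
  refine .of_norm_bounded hs fun k => ?_
  rw [norm_smul, norm_smul, Real.norm_of_nonneg (by positivity),
    Real.norm_of_nonneg (by positivity)]
  gcongr
  have h1 : ((2 * k).factorial : ℝ) ≤ (2 * k + 1).factorial := by
    exact_mod_cast Nat.factorial_le (Nat.le_succ _)
  exact h1.trans (le_mul_of_one_le_left (by positivity) (one_le_pow₀ (by norm_num)))

lemma hasSum_multiset_sum_map {α β : Type*} {f : α → β → ℂ} {g : β → ℂ} {s : Multiset β}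
    (h : ∀ b ∈ s, HasSum (fun i => f i b) (g b)) :
    HasSum (fun i => (s.map (f i)).sum) (s.map g).sum := by
  induction s using Multiset.induction_on with
  | empty => simp
  | cons b s ih =>
    simp only [Multiset.map_cons, Multiset.sum_cons]
    exact (h b (s.mem_cons_self b)).add (ih fun x hx => h x (Multiset.mem_cons_of_mem hx))

/-- For square real matrices near zero, the sinh-determinant equals the exponentiated trace
series: there is `ε > 0` such that for every `n×n` real matrix `A` of operator norm `< ε`,
the series `Σ_{n≥1} 4 c_{2n} Tr(A^{2n})` converges absolutely and
`det(Σ_{k≥0} A^{2k}/(4^k (2k+1)!)) = exp(Σ_{n≥1} 4 c_{2n} Tr(A^{2n}))`, where the `c_{2n}`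
are determined by `Σ c_{2n} x^{2n} = (1/4)·log(sinh(x/2)/(x/2))`. -/
theorem det_sinh_eq_exp_trace_series
    (c : PowerSeries ℚ) (hc0 : PowerSeries.constantCoeff c = 0)
    (hc : expPS (4 * c) = sinhHalfSeries) :
    ∃ ε > (0 : ℝ), ∀ (n : ℕ) (A : Matrix (Fin n) (Fin n) ℝ),
      ‖Matrix.toEuclideanCLM (𝕜 := ℝ) A‖ < ε →
      Summable (fun k : ℕ =>
        |4 * ((PowerSeries.coeff (2 * (k + 1)) c : ℚ) : ℝ) *
          (A ^ (2 * (k + 1))).trace|) ∧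
      (∑' k : ℕ, ((4 ^ k * (2 * k + 1).factorial : ℝ))⁻¹ • A ^ (2 * k)).det =
        Real.exp (∑' k : ℕ,
          4 * ((PowerSeries.coeff (2 * (k + 1)) c : ℚ) : ℝ) *
            (A ^ (2 * (k + 1))).trace) := by
  refine ⟨1 / 4, by norm_num, fun n A hA => ?_⟩
  set B : Matrix (Fin n) (Fin n) ℂ := Complex.ofRealHom.mapMatrix A with hB
  set R := B.charpoly.roots
  have hR (z : ℂ) (hz : z ∈ R) := hasSum_and_exp_eq_of_expPS_eq_sinhHalfSeries hc0 hc
    ((A.norm_le_of_mem_roots_charpoly_map_ofReal hz).trans_lt hA)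
  set t : ℕ → ℂ → ℂ := fun k z =>
    4 * ((PowerSeries.coeff (2 * (k + 1)) c : ℚ) : ℂ) * z ^ (2 * (k + 1))
  have htrace (k : ℕ) : (R.map (t k)).sum = ((4 * ((PowerSeries.coeff (2 * (k + 1)) c : ℚ) : ℝ) *
      (A ^ (2 * (k + 1))).trace : ℝ) : ℂ) := by
    have h1 : (B ^ (2 * (k + 1))).trace = ((A ^ (2 * (k + 1))).trace : ℂ) := by
      rw [hB, ← map_pow]
      exact (AddMonoidHom.map_trace Complex.ofRealHom.toAddMonoidHom _).symm
    rw [Multiset.sum_map_mul_left, ← B.trace_pow_eq_sum_roots_charpoly, h1]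
    simp
  have hsum : HasSum (fun k => (R.map (t k)).sum) (R.map fun z => ∑' k, t k z).sum :=
    hasSum_multiset_sum_map fun z hz => (hR z hz).1.of_norm.hasSum
  simp only [htrace] at hsum
  refine ⟨(Complex.summable_ofReal.mp hsum.summable).abs, ?_⟩
  let p : ℕ → Polynomial ℂ := fun N => ∑ k ∈ Finset.range N,
    Polynomial.C ((4 ^ k * (2 * k + 1).factorial : ℂ))⁻¹ * Polynomial.X ^ (2 * k)
  have hdet (N : ℕ) : (((∑ k ∈ Finset.range N,
      ((4 ^ k * (2 * k + 1).factorial : ℝ))⁻¹ • A ^ (2 * k)).det : ℝ) : ℂ) =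
        (R.map fun z => ∑ k ∈ Finset.range N,
          ((4 ^ k * (2 * k + 1).factorial : ℂ))⁻¹ * z ^ (2 * k)).prod := by
    have h1 : Polynomial.aeval B (p N) = Complex.ofRealHom.mapMatrix (∑ k ∈ Finset.range N,
        ((4 ^ k * (2 * k + 1).factorial : ℝ))⁻¹ • A ^ (2 * k)) := by
      rw [map_sum, map_sum]
      refine Finset.sum_congr rfl fun k _ => ?_
      rw [map_mul, Polynomial.aeval_C, map_pow, Polynomial.aeval_X, ← Algebra.smul_def, hB,
        ← map_pow]
      ext i j
      simp
    have h2 := B.det_aeval_eq_prod_roots_charpoly (p N)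
    rw [h1, ← RingHom.map_det] at h2
    simpa [p, Polynomial.eval_finsetSum] using h2
  have hlim := (Complex.continuous_ofReal.comp
    (Continuous.matrix_det continuous_id)).continuousAt.tendsto.comp
      A.summable_sinh_series.hasSum.tendsto_sum_nat
  have hlim' := tendsto_multiset_prod R fun z hz => (hR z hz).2.tendsto_sum_nat
  simp only [← hdet] at hlim'
  have h := tendsto_nhds_unique hlim hlim'
  have hexp := Complex.exp_multiset_sum (R.map fun z => ∑' k, t k z)
  rw [Multiset.map_map, ← hsum.tsum_eq, ← Complex.ofReal_tsum, ← Complex.ofReal_exp] at hexp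
  exact Complex.ofReal_injective (h.trans hexp.symm)

end
end
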